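/- arXiv:1707.00486 — 11 statements merged into one kernel-verified Lean document; each statement's English description precedes it below -/
import Mathlib

section
/- Let q : X → Θ → ℝ take values in [0,1], and suppose that each ϑ-specific contour is valid at its own parameter value: for every θ ∈ Θ and every α ∈ (0,1), the set {x : q_x(θ) ≤ α} is measurable and P_θ{x : q_x(θ) ≤ α} ≤ α. Define the fused plausibility function pl_x(A) = ⨆_{ϑ ∈ A} q_x(ϑ) for A ⊆ Θ. Then the fused inferential model is valid: for every A ⊆ Θ, every θ ∈ A, and every α ∈ (0,1), the P_θ-outer measure of the set {x : pl_x(A) ≤ α} is at most α. -/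
open MeasureTheory Set

/-- Theorem 2 of the paper: validity of the fused inferential model.
If each ϑ-specific plausibility contour `q · ϑ` is valid at its own parameter value,
then the fused plausibility function `pl x A = ⨆ ϑ ∈ A, q x ϑ` is valid:
for every assertion `A`, every true parameter `θ ∈ A`, and every `α ∈ (0,1)`,
the `P θ`-outer measure of `{x | pl x A ≤ α}` is at most `α`. -/
theorem fused_IM_valid
    {X : Type*} [MeasurableSpace X] {Θ : Type*} [Nonempty Θ]
    (P : Θ → Measure X) (hP : ∀ θ, IsProbabilityMeasure (P θ))
    (q : X → Θ → ℝ)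
    (hq01 : ∀ x θ, q x θ ∈ Icc (0 : ℝ) 1)
    (hmeas : ∀ (θ : Θ), ∀ α ∈ Ioo (0 : ℝ) 1, MeasurableSet {x | q x θ ≤ α})
    (hvalid : ∀ (θ : Θ), ∀ α ∈ Ioo (0 : ℝ) 1,
      P θ {x | q x θ ≤ α} ≤ ENNReal.ofReal α)
    (pl : X → Set Θ → ℝ)
    (hpl : ∀ x A, pl x A = ⨆ ϑ : A, q x (ϑ : Θ)) :
    ∀ (A : Set Θ), ∀ θ ∈ A, ∀ α ∈ Ioo (0 : ℝ) 1,
      P θ {x | pl x A ≤ α} ≤ ENNReal.ofReal α := by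
  intro A θ hθ α hα
  refine (measure_mono fun x hx => ?_).trans (hvalid θ α hα)
  have hbdd : BddAbove (range fun ϑ : A => q x (ϑ : Θ)) :=
    ⟨1, forall_mem_range.2 fun ϑ => (hq01 x ϑ).2⟩
  calc q x θ ≤ ⨆ ϑ : A, q x (ϑ : Θ) := le_ciSup hbdd ⟨θ, hθ⟩
    _ = pl x A := (hpl x A).symm
    _ ≤ α := hx
end

section
/- Let p : X → Θ → ℝ be a valid contour, i.e., p takes values in [0,1] and for every θ ∈ Θ and α ∈ (0,1) the set {x : p_x(θ) ≤ α} is measurable with P_θ{x : p_x(θ) ≤ α} ≤ α. Define the consonant belief function bel_x(A) = 1 − ⨆_{ϑ ∈ Aᶜ} p_x(ϑ) for A ⊆ Θ. Then for every A ⊆ Θ, every θ ∉ A, and every α ∈ (0,1), the P_θ-outer measure of the set {x : bel_x(A) ≥ 1 − α} is at most α. -/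
open MeasureTheory Set

/-- If `p` is a valid plausibility contour, then the corresponding consonant belief
function `bel x A = 1 - ⨆ ϑ ∈ Aᶜ, p x ϑ` satisfies: for every `A ⊆ Θ`, every `θ ∉ A`,
and every `α ∈ (0,1)`, the `P θ`-outer measure of `{x | bel x A ≥ 1 - α}` is at most `α`. -/
theorem consonant_belief_valid
    {X : Type*} [MeasurableSpace X] {Θ : Type*} [Nonempty Θ]
    (P : Θ → Measure X) (hP : ∀ θ, IsProbabilityMeasure (P θ))
    (p : X → Θ → ℝ)
    (hp01 : ∀ x θ, p x θ ∈ Icc (0 : ℝ) 1)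
    (hmeas : ∀ (θ : Θ), ∀ α ∈ Ioo (0 : ℝ) 1, MeasurableSet {x | p x θ ≤ α})
    (hvalid : ∀ (θ : Θ), ∀ α ∈ Ioo (0 : ℝ) 1,
      P θ {x | p x θ ≤ α} ≤ ENNReal.ofReal α)
    (bel : X → Set Θ → ℝ)
    (hbel : ∀ x A, bel x A = 1 - ⨆ ϑ : ↥Aᶜ, p x (ϑ : Θ)) :
    ∀ (A : Set Θ), ∀ θ ∉ A, ∀ α ∈ Ioo (0 : ℝ) 1,
      P θ {x | 1 - α ≤ bel x A} ≤ ENNReal.ofReal α := by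
  intro A θ hθ α hα
  refine (measure_mono fun x hx => ?_).trans (hvalid θ α hα)
  have hbdd : BddAbove (range fun ϑ : ↥Aᶜ => p x (ϑ : Θ)) :=
    ⟨1, forall_mem_range.2 fun ϑ => (hp01 x ϑ).2⟩
  have hle : p x θ ≤ ⨆ ϑ : ↥Aᶜ, p x (ϑ : Θ) := le_ciSup hbdd ⟨θ, hθ⟩
  rw [mem_ofPred_eq, hbel] at hx
  rw [mem_ofPred_eq]
  linarith
end

section
/- Suppose that for every θ ∈ Θ and α ∈ (0,1) the sets {x : θ ∈ C_α(x)} and {x : p_x(θ) ≤ α} are measurable. Then the coverage condition [for every θ ∈ Θ and α ∈ (0,1), P_θ{x : θ ∈ C_α(x)} ≥ 1 − α] holds if and only if the contour validity condition [for every θ ∈ Θ and α ∈ (0,1), P_θ{x : p_x(θ) ≤ α} ≤ α] holds. -/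
open MeasureTheory Set

/-- Under a probability measure, a measurable event has probability at least `1 - α` iff its
complement has probability at most `α`. -/
theorem ofReal_one_sub_le_measure_iff {X : Type*} [MeasurableSpace X] (μ : Measure X)
    [IsProbabilityMeasure μ] {s : Set X} (hs : MeasurableSet s) {α : ℝ} (hα : 0 ≤ α) :
    ENNReal.ofReal (1 - α) ≤ μ s ↔ μ sᶜ ≤ ENNReal.ofReal α := by
  rw [← ofReal_measureReal (μ := μ) (s := s), ← ofReal_measureReal (μ := μ) (s := sᶜ),
    ENNReal.ofReal_le_ofReal_iff measureReal_nonneg, ENNReal.ofReal_le_ofReal_iff hα,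
    probReal_compl_eq_one_sub hs]
  exact sub_le_comm

/-- The levels `α ∈ (0,1)` satisfying a predicate, together with `0`, are bounded above. -/
theorem bddAbove_zero_union_levels (Q : ℝ → Prop) :
    BddAbove ({0} ∪ {α : ℝ | 0 < α ∧ α < 1 ∧ Q α}) := by
  refine ⟨1, ?_⟩
  rintro β (rfl | ⟨-, hβ, -⟩)
  · exact zero_le_one
  · exact hβ.le

/-- For a nested family of region estimators `C`, with plausibility contour
`p x ϑ = sSup ({0} ∪ {α ∈ (0,1) | ϑ ∈ C α x})`, the coverage condition
`P θ {x | θ ∈ C α x} ≥ 1 - α` holds for all `θ` and `α ∈ (0,1)` if and only if the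
contour validity condition `P θ {x | p x θ ≤ α} ≤ α` holds for all `θ` and `α ∈ (0,1)`. -/
theorem coverage_iff_contour_valid
    {X : Type*} [MeasurableSpace X] {Θ : Type*} [Nonempty Θ]
    (P : Θ → Measure X) (hP : ∀ θ, IsProbabilityMeasure (P θ))
    (C : ℝ → X → Set Θ)
    (hnested : ∀ (x : X), ∀ α ∈ Ioo (0:ℝ) 1, ∀ α' ∈ Ioo (0:ℝ) 1, α' ≤ α → C α x ⊆ C α' x)
    (p : X → Θ → ℝ)
    (hp : ∀ x ϑ, p x ϑ = sSup ({0} ∪ {α : ℝ | 0 < α ∧ α < 1 ∧ ϑ ∈ C α x}))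
    (hmC : ∀ (θ : Θ), ∀ α ∈ Ioo (0:ℝ) 1, MeasurableSet {x | θ ∈ C α x})
    (hmp : ∀ (θ : Θ), ∀ α ∈ Ioo (0:ℝ) 1, MeasurableSet {x | p x θ ≤ α}) :
    (∀ (θ : Θ), ∀ α ∈ Ioo (0:ℝ) 1, ENNReal.ofReal (1 - α) ≤ P θ {x | θ ∈ C α x}) ↔
    (∀ (θ : Θ), ∀ α ∈ Ioo (0:ℝ) 1, P θ {x | p x θ ≤ α} ≤ ENNReal.ofReal α) := by
  constructor
  · intro h θ α hα
    have := hP θ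
    refine le_of_forall_gt_imp_ge_of_dense fun b hb => ?_
    obtain ⟨β, hβ0, hαβ, hβb⟩ := ENNReal.lt_iff_exists_real_btwn.1 hb
    rw [ENNReal.ofReal_lt_ofReal_iff_of_nonneg hα.1.le] at hαβ
    refine le_trans ?_ hβb.le
    rcases le_or_gt 1 β with hβ1 | hβ1
    · exact prob_le_one.trans (ENNReal.one_le_ofReal.2 hβ1)
    · have hβ : β ∈ Ioo (0 : ℝ) 1 := ⟨hα.1.trans hαβ, hβ1⟩
      refine le_trans (measure_mono ?_)
        ((ofReal_one_sub_le_measure_iff (P θ) (hmC θ β hβ) hβ0).1 (h θ β hβ))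
      intro x hx hxC
      have hle : β ≤ p x θ := by
        rw [hp]
        exact le_csSup (bddAbove_zero_union_levels _) (Or.inr ⟨hβ.1, hβ.2, hxC⟩)
      exact (hle.trans hx).not_gt hαβ
  · intro h θ α hα
    have := hP θ
    refine (ofReal_one_sub_le_measure_iff (P θ) (hmC θ α hα) hα.1.le).2
      (le_trans (measure_mono ?_) (h θ α hα))
    intro x hx
    rw [mem_ofPred_eq, hp]
    refine csSup_le ⟨0, Or.inl rfl⟩ ?_
    rintro β (rfl | ⟨hβ0, hβ1, hβC⟩)
    · exact hα.1.le
    · by_contra! hαβ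
      exact hx (hnested x β ⟨hβ0, hβ1⟩ α hα hαβ.le hβC)
end

section
/- Define the consonant belief function bel_x(A) = 1 − ⨆_{ϑ ∈ Aᶜ} p_x(ϑ) for A ⊆ Θ. Then for every x ∈ X and every α ∈ (0,1), bel_x(C_α(x)) ≥ 1 − α; equivalently, sup_{ϑ ∉ C_α(x)} p_x(ϑ) ≤ α. -/
open Set

/-- For a nested family of region estimators `C` with derived plausibility contour
`p x ϑ = sSup ({0} ∪ {α ∈ (0,1) | ϑ ∈ C α x})` and consonant belief function
`bel x A = 1 - ⨆ ϑ ∈ Aᶜ, p x ϑ`, one has `bel x (C α x) ≥ 1 - α`; equivalently,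
`⨆ ϑ ∉ C α x, p x ϑ ≤ α`. -/
theorem belief_of_confidence_region
    {X : Type*} {Θ : Type*} [Nonempty Θ]
    (C : ℝ → X → Set Θ)
    (hnested : ∀ (x : X), ∀ α ∈ Ioo (0:ℝ) 1, ∀ α' ∈ Ioo (0:ℝ) 1, α' ≤ α → C α x ⊆ C α' x)
    (p : X → Θ → ℝ)
    (hp : ∀ x ϑ, p x ϑ = sSup ({0} ∪ {α : ℝ | 0 < α ∧ α < 1 ∧ ϑ ∈ C α x}))
    (bel : X → Set Θ → ℝ)
    (hbel : ∀ x A, bel x A = 1 - ⨆ ϑ : ↥Aᶜ, p x (ϑ : Θ)) :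
    ∀ (x : X), ∀ α ∈ Ioo (0:ℝ) 1,
      1 - α ≤ bel x (C α x) ∧ (⨆ ϑ : ↥(C α x)ᶜ, p x (ϑ : Θ)) ≤ α := by
  intro x α hα
  have hsup : (⨆ ϑ : ↥(C α x)ᶜ, p x (ϑ : Θ)) ≤ α := by
    refine Real.iSup_le (fun ϑ => ?_) hα.1.le
    rw [hp]
    refine Real.sSup_le ?_ hα.1.le
    rintro β (rfl | ⟨hβ0, hβ1, hβ⟩)
    · exact hα.1.le
    · by_contra! h
      exact ϑ.2 (hnested x β ⟨hβ0, hβ1⟩ α hα h.le hβ)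
  refine ⟨?_, hsup⟩
  rw [hbel]
  linarith
end

section
/- Let p : X → Θ → ℝ be a valid contour, i.e., p takes values in [0,1] and for every θ ∈ Θ and α ∈ (0,1) the set {x : p_x(θ) ≤ α} is measurable with P_θ{x : p_x(θ) ≤ α} ≤ α. Let φ : Θ → Φ be any map, define the marginal plausibility contour mp_x(φ') = ⨆_{ϑ : φ(ϑ) = φ'} p_x(ϑ), and the marginal plausibility region Π^φ_α(x) = {φ' ∈ Φ : mp_x(φ') > α}. Then for every θ ∈ Θ and every α ∈ (0,1), the P_θ-outer measure of {x : φ(θ) ∉ Π^φ_α(x)} is at most α; in particular Π^φ_α(X) is a 100(1−α)% confidence region for φ(θ). -/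
open MeasureTheory Set

/-- If `p` is a valid plausibility contour, then for any interest parameter `φ : Θ → Φ`,
the marginal plausibility contour `mp x φ' = ⨆ ϑ : φ ϑ = φ', p x ϑ` yields marginal
plausibility regions `Reg α x = {φ' | mp x φ' > α}` that are nominal 100(1-α)% confidence
regions: the `P θ`-outer measure of `{x | φ θ ∉ Reg α x}` is at most `α`. -/
theorem marginal_plausibility_region_valid
    {X : Type*} [MeasurableSpace X] {Θ : Type*} [Nonempty Θ] {Φ : Type*}
    (P : Θ → Measure X) (hP : ∀ θ, IsProbabilityMeasure (P θ))
    (p : X → Θ → ℝ)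
    (hp01 : ∀ x θ, p x θ ∈ Icc (0 : ℝ) 1)
    (hmeas : ∀ (θ : Θ), ∀ α ∈ Ioo (0 : ℝ) 1, MeasurableSet {x | p x θ ≤ α})
    (hvalid : ∀ (θ : Θ), ∀ α ∈ Ioo (0 : ℝ) 1,
      P θ {x | p x θ ≤ α} ≤ ENNReal.ofReal α)
    (φ : Θ → Φ)
    (mp : X → Φ → ℝ)
    (hmp : ∀ x φ', mp x φ' = ⨆ ϑ : {ϑ : Θ // φ ϑ = φ'}, p x (ϑ : Θ))
    (Reg : ℝ → X → Set Φ)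
    (hReg : ∀ α x, Reg α x = {φ' : Φ | α < mp x φ'}) :
    ∀ (θ : Θ), ∀ α ∈ Ioo (0 : ℝ) 1,
      P θ {x | φ θ ∉ Reg α x} ≤ ENNReal.ofReal α := by
  intro θ α hα
  refine (measure_mono fun x hx => ?_).trans (hvalid θ α hα)
  have hbdd : BddAbove (range fun ϑ : {ϑ : Θ // φ ϑ = φ θ} => p x (ϑ : Θ)) :=
    ⟨1, forall_mem_range.2 fun ϑ => (hp01 x ϑ).2⟩
  have hle : p x θ ≤ mp x (φ θ) := by
    rw [hmp]
    exact le_ciSup hbdd ⟨θ, rfl⟩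
  rw [mem_ofPred_eq, hReg, mem_ofPred_eq, not_lt] at hx
  exact hle.trans hx
end

section
/- Let φ : Θ → Φ be any map, define the marginal plausibility contour mp_x(φ') = ⨆_{ϑ : φ(ϑ) = φ'} p_x(ϑ), and the marginal plausibility region Π^φ_α(x) = {φ' ∈ Φ : mp_x(φ') > α}. Then for every x ∈ X and every α ∈ (0,1), Π^φ_α(x) is contained in the image φ''(C_α(x)) = {φ(ϑ) : ϑ ∈ C_α(x)}, i.e., the marginal plausibility region is contained in the naive projection of the confidence region onto the φ-margin. -/
open Set

/-- For a nested family of region estimators `C` with derived plausibility contour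
`p x ϑ = sSup ({0} ∪ {α ∈ (0,1) | ϑ ∈ C α x})`, the marginal plausibility region
for `φ = φ(θ)` is contained in the naive projection of `C α x` onto the `φ`-margin. -/
theorem marginal_plausibility_region_subset_projection
    {X : Type*} {Θ : Type*} [Nonempty Θ] {Φ : Type*}
    (C : ℝ → X → Set Θ)
    (hnested : ∀ (x : X), ∀ α ∈ Ioo (0:ℝ) 1, ∀ α' ∈ Ioo (0:ℝ) 1, α' ≤ α → C α x ⊆ C α' x)
    (p : X → Θ → ℝ)
    (hp : ∀ x ϑ, p x ϑ = sSup ({0} ∪ {α : ℝ | 0 < α ∧ α < 1 ∧ ϑ ∈ C α x}))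
    (φ : Θ → Φ)
    (mp : X → Φ → ℝ)
    (hmp : ∀ x φ', mp x φ' = ⨆ ϑ : {ϑ : Θ // φ ϑ = φ'}, p x (ϑ : Θ))
    (Reg : ℝ → X → Set Φ)
    (hReg : ∀ α x, Reg α x = {φ' : Φ | α < mp x φ'}) :
    ∀ (x : X), ∀ α ∈ Ioo (0:ℝ) 1, Reg α x ⊆ φ '' (C α x) := by
  intro x α hα φ' hφ'
  rw [hReg, mem_ofPred_eq, hmp] at hφ'
  rcases isEmpty_or_nonempty {ϑ : Θ // φ ϑ = φ'} with h | h
  · rw [Real.iSup_of_isEmpty] at hφ'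
    exact absurd hφ' hα.1.not_gt
  obtain ⟨⟨ϑ, hϑ⟩, hlt⟩ := exists_lt_of_lt_ciSup hφ'
  rw [hp] at hlt
  obtain ⟨β, hβ, hαβ⟩ := exists_lt_of_lt_csSup ((singleton_nonempty _).inl) hlt
  rcases hβ with rfl | ⟨hβ0, hβ1, hmem⟩
  · exact absurd hαβ hα.1.not_gt
  · exact ⟨ϑ, hnested x β ⟨hβ0, hβ1⟩ α hα hαβ.le hmem, hϑ⟩
end

section
/- Let μ be a probability measure on a measurable space U and let S : ℝ → Set U, defined for α ∈ (0,1), be a family of measurable sets that is antitone: for α, α' ∈ (0,1) with α ≤ α', S_{α'} ⊆ S_α. Define f(u) = 1 − sSup({0} ∪ {μ(S_α) : α ∈ (0,1), u ∉ S_α}). Then for every t ∈ (0,1), the μ-outer measure of the set {u ∈ U : f(u) ≤ t} is at most t. -/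
open MeasureTheory Set

/-- Core calibration property behind Theorem 1 of the paper, for predictive random sets
with nested (antitone) measurable support `S : ℝ → Set U` and distribution prescribed by
condition P2: the hitting probability `f u = 1 - sSup ({0} ∪ {μ (S α) | α ∈ (0,1), u ∉ S α})`
satisfies, for every `t ∈ (0,1)`, that the `μ`-outer measure of `{u | f u ≤ t}` is at most `t`. -/
theorem nested_random_set_calibration
    {U : Type*} [MeasurableSpace U]
    (μ : Measure U) [IsProbabilityMeasure μ]
    (S : ℝ → Set U)
    (hSmeas : ∀ α ∈ Ioo (0:ℝ) 1, MeasurableSet (S α))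
    (hanti : ∀ α ∈ Ioo (0:ℝ) 1, ∀ α' ∈ Ioo (0:ℝ) 1, α ≤ α' → S α' ⊆ S α)
    (f : U → ℝ)
    (hf : ∀ u, f u = 1 -
      sSup ({0} ∪ {r : ℝ | ∃ α, 0 < α ∧ α < 1 ∧ u ∉ S α ∧ r = (μ (S α)).toReal})) :
    ∀ t ∈ Ioo (0:ℝ) 1, μ {u | f u ≤ t} ≤ ENNReal.ofReal t := by
  intro t ht
  refine ENNReal.le_of_forall_pos_le_add fun ε hε _ => ?_
  set d : ℝ := 1 - t - ε
  let T : Set ℝ := {α | α ∈ Ioo (0:ℝ) 1 ∧ d < (μ (S α)).toReal}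
  have hT : T.OrdConnected := by
    refine ⟨fun x hx y hy z hz => ?_⟩
    have hz01 : z ∈ Ioo (0:ℝ) 1 := ⟨hx.1.1.trans_le hz.1, hz.2.trans_lt hy.1.2⟩
    exact ⟨hz01, hy.2.trans_le <| ENNReal.toReal_mono (measure_ne_top μ _) <|
      measure_mono (hanti z hz01 y hy.1 hz.2)⟩
  have hmono : Monotone fun α : T => (S α)ᶜ := fun α β h =>
    compl_subset_compl.2 (hanti α α.2.1 β β.2.1 h)
  have hsub : {u | f u ≤ t} ⊆ ⋃ α : T, (S α)ᶜ := by
    intro u hu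
    have hlt : max d 0 < sSup ({0} ∪
        {r : ℝ | ∃ α, 0 < α ∧ α < 1 ∧ u ∉ S α ∧ r = (μ (S α)).toReal}) := by
      have hu' : f u ≤ t := hu
      have hε' : (0:ℝ) < ε := hε
      rw [hf u] at hu'
      exact max_lt (by linarith) (by linarith [ht.2])
    obtain ⟨r, hr, hdr⟩ := exists_lt_of_lt_csSup ⟨0, mem_union_left _ (mem_singleton 0)⟩ hlt
    obtain rfl | ⟨α, h0, h1, huα, rfl⟩ := hr
    · exact absurd (le_max_right d 0) hdr.not_ge
    · exact mem_iUnion.2 ⟨⟨α, ⟨h0, h1⟩, (le_max_left d 0).trans_lt hdr⟩, huα⟩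
  refine (measure_mono hsub).trans ?_
  rw [hmono.measure_iUnion]
  refine iSup_le fun α => ?_
  have hα : (μ (S α)ᶜ).toReal ≤ t + ε := by
    have h : μ.real (S α)ᶜ = 1 - μ.real (S α) := probReal_compl_eq_one_sub (hSmeas α α.2.1)
    have h' : d < μ.real (S α) := α.2.2
    change μ.real (S α)ᶜ ≤ t + ε
    linarith
  rw [← ENNReal.ofReal_coe_nnreal, ← ENNReal.ofReal_add ht.1.le ε.coe_nonneg]
  exact (ENNReal.le_ofReal_iff_toReal_le (measure_ne_top μ _)
    (add_nonneg ht.1.le ε.coe_nonneg)).2 hα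
end

section
/- Assume the coverage condition: μ(S_α(ϑ)) ≥ 1 − α for every ϑ ∈ Θ and α ∈ (0,1). Then for every x ∈ X, every α ∈ (0,1), and every ϑ ∈ Θ with q_x(ϑ) > α, one has φ(ϑ) ∈ C_α(x). Consequently the marginal plausibility region {φ' ∈ Φ : ∃ϑ, φ(ϑ) = φ' and q_x(ϑ) > α} is contained in C_α(x). -/
open MeasureTheory Set

/-- Containment half of Theorem 3 (the complete-class theorem): under the coverage
condition `μ (S α ϑ) ≥ 1 - α`, whenever `q x ϑ > α` one has `φ ϑ ∈ C α x`; consequently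
the marginal plausibility region `{φ' | ∃ ϑ, φ ϑ = φ' ∧ q x ϑ > α}` is contained in `C α x`. -/
theorem constructed_region_subset_confidence
    {X U : Type*} [MeasurableSpace X] [MeasurableSpace U]
    (μ : Measure U) [IsProbabilityMeasure μ]
    {Θ : Type*} [Nonempty Θ] {Φ : Type*}
    (φ : Θ → Φ)
    (P : Θ → Measure X)
    (a : Θ → U → X)
    (hameas : ∀ ϑ : Θ, Measurable (a ϑ))
    (hpush : ∀ ϑ : Θ, Measure.map (a ϑ) μ = P ϑ)
    (C : ℝ → X → Set Φ)
    (hnested : ∀ (x : X), ∀ α ∈ Ioo (0:ℝ) 1, ∀ α' ∈ Ioo (0:ℝ) 1, α' ≤ α → C α x ⊆ C α' x)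
    (S : ℝ → Θ → Set U)
    (hS : ∀ α ϑ, S α ϑ = {u : U | φ ϑ ∈ C α (a ϑ u)})
    (hSmeas : ∀ α ∈ Ioo (0:ℝ) 1, ∀ ϑ : Θ, MeasurableSet (S α ϑ))
    (Ux : X → Θ → Set U)
    (hUx : ∀ x ϑ, Ux x ϑ = {u : U | a ϑ u = x})
    (q : X → Θ → ℝ)
    (hq : ∀ x ϑ, q x ϑ = 1 -
      sSup ({0} ∪ {r : ℝ | ∃ α, 0 < α ∧ α < 1 ∧ S α ϑ ∩ Ux x ϑ = ∅ ∧
        r = (μ (S α ϑ)).toReal}))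
    (hcov : ∀ ϑ : Θ, ∀ α ∈ Ioo (0:ℝ) 1, ENNReal.ofReal (1 - α) ≤ μ (S α ϑ)) :
    ∀ (x : X), ∀ α ∈ Ioo (0:ℝ) 1,
      (∀ ϑ : Θ, α < q x ϑ → φ ϑ ∈ C α x) ∧
      {φ' : Φ | ∃ ϑ : Θ, φ ϑ = φ' ∧ α < q x ϑ} ⊆ C α x := by
  intro x α hα
  have mem_of_lt : ∀ ϑ : Θ, α < q x ϑ → φ ϑ ∈ C α x := by
    intro ϑ hlt
    by_contra hmem
    have hdisj : S α ϑ ∩ Ux x ϑ = ∅ := by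
      ext u
      simp only [hS, hUx, mem_inter_iff, mem_ofPred_eq, mem_empty_iff_false, iff_false, not_and]
      rintro hu rfl
      exact hmem hu
    have hbdd : BddAbove ({0} ∪ {r : ℝ | ∃ α, 0 < α ∧ α < 1 ∧ S α ϑ ∩ Ux x ϑ = ∅ ∧
        r = (μ (S α ϑ)).toReal}) := by
      refine ⟨1, ?_⟩
      rintro r (rfl | ⟨β, -, -, -, rfl⟩)
      · exact zero_le_one
      · exact measureReal_le_one
    have hle := le_csSup hbdd (Or.inr ⟨α, hα.1, hα.2, hdisj, rfl⟩)
    have hcov_real : 1 - α ≤ (μ (S α ϑ)).toReal :=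
      (ENNReal.ofReal_le_iff_le_toReal (measure_ne_top μ _)).1 (hcov ϑ α hα)
    rw [hq] at hlt
    linarith
  refine ⟨mem_of_lt, ?_⟩
  rintro _ ⟨ϑ, rfl, hlt⟩
  exact mem_of_lt ϑ hlt
end

section
/- Assume the coverage condition μ(S_α(ϑ)) ≥ 1 − α for every ϑ ∈ Θ and α ∈ (0,1), and define the index α(x,ϑ) = sSup({0} ∪ {α ∈ (0,1) : S_α(ϑ) ∩ U_x(ϑ) ≠ ∅}). Then for every x ∈ X and ϑ ∈ Θ, q_x(ϑ) ≤ α(x,ϑ). -/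
open MeasureTheory Set

/-- The displayed inequality `pl_x({ϑ}|ϑ) ≤ α(x,ϑ)` in the proof of Theorem 3: under the
coverage condition `μ (S α ϑ) ≥ 1 - α`, the constructed contour `q` is bounded by the
index `αidx x ϑ = sSup ({0} ∪ {α ∈ (0,1) | S α ϑ ∩ Ux x ϑ ≠ ∅})`. -/
theorem constructed_contour_le_index
    {X U : Type*} [MeasurableSpace X] [MeasurableSpace U]
    (μ : Measure U) [IsProbabilityMeasure μ]
    {Θ : Type*} [Nonempty Θ] {Φ : Type*}
    (φ : Θ → Φ)
    (P : Θ → Measure X)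
    (a : Θ → U → X)
    (hameas : ∀ ϑ : Θ, Measurable (a ϑ))
    (hpush : ∀ ϑ : Θ, Measure.map (a ϑ) μ = P ϑ)
    (C : ℝ → X → Set Φ)
    (hnested : ∀ (x : X), ∀ α ∈ Ioo (0:ℝ) 1, ∀ α' ∈ Ioo (0:ℝ) 1, α' ≤ α → C α x ⊆ C α' x)
    (S : ℝ → Θ → Set U)
    (hS : ∀ α ϑ, S α ϑ = {u : U | φ ϑ ∈ C α (a ϑ u)})
    (hSmeas : ∀ α ∈ Ioo (0:ℝ) 1, ∀ ϑ : Θ, MeasurableSet (S α ϑ))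
    (Ux : X → Θ → Set U)
    (hUx : ∀ x ϑ, Ux x ϑ = {u : U | a ϑ u = x})
    (q : X → Θ → ℝ)
    (hq : ∀ x ϑ, q x ϑ = 1 -
      sSup ({0} ∪ {r : ℝ | ∃ α, 0 < α ∧ α < 1 ∧ S α ϑ ∩ Ux x ϑ = ∅ ∧
        r = (μ (S α ϑ)).toReal}))
    (hcov : ∀ ϑ : Θ, ∀ α ∈ Ioo (0:ℝ) 1, ENNReal.ofReal (1 - α) ≤ μ (S α ϑ))
    (αidx : X → Θ → ℝ)
    (hαidx : ∀ x ϑ, αidx x ϑ =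
      sSup ({0} ∪ {α : ℝ | 0 < α ∧ α < 1 ∧ S α ϑ ∩ Ux x ϑ ≠ ∅})) :
    ∀ (x : X) (ϑ : Θ), q x ϑ ≤ αidx x ϑ := by
  intro x ϑ
  rw [hq, hαidx]
  set A : Set ℝ := {0} ∪ {r : ℝ | ∃ α, 0 < α ∧ α < 1 ∧ S α ϑ ∩ Ux x ϑ = ∅ ∧
    r = (μ (S α ϑ)).toReal}
  set B : Set ℝ := {0} ∪ {α : ℝ | 0 < α ∧ α < 1 ∧ S α ϑ ∩ Ux x ϑ ≠ ∅}
  have hA : BddAbove A := by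
    refine ⟨1, ?_⟩
    rintro r (rfl | ⟨α, -, -, -, rfl⟩)
    · exact zero_le_one
    · exact measureReal_le_one
  have hB : BddAbove B := by
    refine ⟨1, ?_⟩
    rintro r (rfl | ⟨-, h, -⟩)
    · exact zero_le_one
    · exact h.le
  have hA0 : 0 ≤ sSup A := le_csSup hA (Or.inl rfl)
  have hB0 : 0 ≤ sSup B := le_csSup hB (Or.inl rfl)
  by_contra! hlt
  obtain ⟨α, hα, hα'⟩ := exists_between hlt
  have h0 : 0 < α := hB0.trans_lt hα
  have h1 : α < 1 := by linarith
  have hempty : S α ϑ ∩ Ux x ϑ = ∅ := by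
    by_contra hne
    exact hα.not_ge (le_csSup hB (Or.inr ⟨h0, h1, hne⟩))
  have hle : (μ (S α ϑ)).toReal ≤ sSup A :=
    le_csSup hA (Or.inr ⟨α, h0, h1, hempty, rfl⟩)
  have hge : 1 - α ≤ (μ (S α ϑ)).toReal :=
    (ENNReal.ofReal_le_iff_le_toReal (measure_ne_top μ _)).1 (hcov ϑ α ⟨h0, h1⟩)
  linarith
end

section
/- Assume the exact coverage condition: μ(S_α(ϑ)) = 1 − α for every ϑ ∈ Θ and α ∈ (0,1). Then for every x ∈ X and ϑ ∈ Θ, the constructed contour equals the index: q_x(ϑ) = sSup({0} ∪ {α ∈ (0,1) : S_α(ϑ) ∩ U_x(ϑ) ≠ ∅}). -/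
open MeasureTheory Set

/-- For a predicate on `(0,1)` that is closed downwards, the supremum of the points where it
holds and the supremum of `1 - α` over the points `α` where it fails add up to one. -/
theorem one_sub_sSup_compl_eq_sSup {p : ℝ → Prop}
    (hp : ∀ α ∈ Ioo (0:ℝ) 1, ∀ α' ∈ Ioo (0:ℝ) 1, α' ≤ α → p α → p α') :
    1 - sSup ({0} ∪ {r : ℝ | ∃ α, 0 < α ∧ α < 1 ∧ ¬ p α ∧ r = 1 - α}) =
      sSup ({0} ∪ {α : ℝ | 0 < α ∧ α < 1 ∧ p α}) := by
  set s := sSup ({0} ∪ {α : ℝ | 0 < α ∧ α < 1 ∧ p α})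
  have hbdd : BddAbove ({0} ∪ {α : ℝ | 0 < α ∧ α < 1 ∧ p α}) := by
    refine ⟨1, ?_⟩
    rintro y (rfl | ⟨-, hy, -⟩)
    · exact zero_le_one
    · exact hy.le
  have hne : ({0} ∪ {α : ℝ | 0 < α ∧ α < 1 ∧ p α}).Nonempty := ⟨0, Or.inl rfl⟩
  have hs0 : 0 ≤ s := le_csSup hbdd (Or.inl rfl)
  have hlub : IsLUB ({0} ∪ {r : ℝ | ∃ α, 0 < α ∧ α < 1 ∧ ¬ p α ∧ r = 1 - α}) (1 - s) := by
    constructor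
    · rintro r (rfl | ⟨α, h0, h1, hα, rfl⟩)
      · refine sub_nonneg.2 (csSup_le hne ?_)
        rintro y (rfl | ⟨-, hy, -⟩)
        · exact zero_le_one
        · exact hy.le
      · refine sub_le_sub_left (csSup_le hne ?_) 1
        rintro y (rfl | ⟨hy0, hy1, hy⟩)
        · exact h0.le
        · by_contra! h
          exact hα (hp y ⟨hy0, hy1⟩ α ⟨h0, h1⟩ h.le hy)
    · intro b hb
      have hb0 : 0 ≤ b := hb (Or.inl rfl)
      by_contra! h
      obtain ⟨α, hsα, hαb⟩ := exists_between (show s < 1 - b by linarith)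
      have h0 : 0 < α := hs0.trans_lt hsα
      have h1 : α < 1 := by linarith
      have hα : ¬ p α := fun hpα => hsα.not_ge (le_csSup hbdd (Or.inr ⟨h0, h1, hpα⟩))
      have : 1 - α ≤ b := hb (Or.inr ⟨α, h0, h1, hα, rfl⟩)
      linarith
  rw [hlub.csSup_eq ⟨0, Or.inl rfl⟩, sub_sub_cancel]

/-- The exactness step in Theorem 3: under the exact coverage condition
`μ (S α ϑ) = 1 - α` for all `ϑ` and `α ∈ (0,1)`, the constructed contour equals the
index: `q x ϑ = sSup ({0} ∪ {α ∈ (0,1) | S α ϑ ∩ Ux x ϑ ≠ ∅})`. -/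
theorem constructed_contour_eq_index
    {X U : Type*} [MeasurableSpace X] [MeasurableSpace U]
    (μ : Measure U) [IsProbabilityMeasure μ]
    {Θ : Type*} [Nonempty Θ] {Φ : Type*}
    (φ : Θ → Φ)
    (P : Θ → Measure X)
    (a : Θ → U → X)
    (hameas : ∀ ϑ : Θ, Measurable (a ϑ))
    (hpush : ∀ ϑ : Θ, Measure.map (a ϑ) μ = P ϑ)
    (C : ℝ → X → Set Φ)
    (hnested : ∀ (x : X), ∀ α ∈ Ioo (0:ℝ) 1, ∀ α' ∈ Ioo (0:ℝ) 1, α' ≤ α → C α x ⊆ C α' x)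
    (S : ℝ → Θ → Set U)
    (hS : ∀ α ϑ, S α ϑ = {u : U | φ ϑ ∈ C α (a ϑ u)})
    (hSmeas : ∀ α ∈ Ioo (0:ℝ) 1, ∀ ϑ : Θ, MeasurableSet (S α ϑ))
    (Ux : X → Θ → Set U)
    (hUx : ∀ x ϑ, Ux x ϑ = {u : U | a ϑ u = x})
    (q : X → Θ → ℝ)
    (hq : ∀ x ϑ, q x ϑ = 1 -
      sSup ({0} ∪ {r : ℝ | ∃ α, 0 < α ∧ α < 1 ∧ S α ϑ ∩ Ux x ϑ = ∅ ∧
        r = (μ (S α ϑ)).toReal}))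
    (hcov : ∀ ϑ : Θ, ∀ α ∈ Ioo (0:ℝ) 1, μ (S α ϑ) = ENNReal.ofReal (1 - α)) :
    ∀ (x : X) (ϑ : Θ),
      q x ϑ = sSup ({0} ∪ {α : ℝ | 0 < α ∧ α < 1 ∧ S α ϑ ∩ Ux x ϑ ≠ ∅}) := by
  intro x ϑ
  have hdown : ∀ α ∈ Ioo (0:ℝ) 1, ∀ α' ∈ Ioo (0:ℝ) 1, α' ≤ α →
      S α ϑ ∩ Ux x ϑ ≠ ∅ → S α' ϑ ∩ Ux x ϑ ≠ ∅ := by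
    intro α hα α' hα' hle h
    obtain ⟨u, huS, huU⟩ := nonempty_iff_ne_empty.2 h
    rw [hS] at huS
    refine nonempty_iff_ne_empty.1 ⟨u, ?_, huU⟩
    rw [hS]
    exact hnested _ α hα α' hα' hle huS
  rw [hq, ← one_sub_sSup_compl_eq_sSup hdown]
  congr 3
  ext r
  refine exists_congr fun α => and_congr_right fun h0 => and_congr_right fun h1 => ?_
  rw [hcov ϑ α ⟨h0, h1⟩, ENNReal.toReal_ofReal (sub_nonneg.2 h1.le), not_ne_iff]
end

section
/- Let n ≥ 1 be a natural number and let α ∈ (0,1). The Lebesgue measure (volume on ℝⁿ) of the set of points y ∈ [0,1]ⁿ satisfying (α/(2−α))·(1 − max_i y_i) ≤ min_i y_i and min_i y_i ≤ ((2−α)/α)·(1 − max_i y_i) equals 1 − α. -/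
open MeasureTheory Set

/-- The points whose least coordinate is attained at `i` and at no smaller index. -/
def firstArgmin {n : ℕ} (i : Fin n) : Set (Fin n → ℝ) :=
  {y | (∀ j, y i ≤ y j) ∧ ∀ j < i, y i < y j}

lemma measurableSet_firstArgmin {n : ℕ} (i : Fin n) : MeasurableSet (firstArgmin i) := by
  unfold firstArgmin
  measurability

lemma pairwise_disjoint_firstArgmin {n : ℕ} :
    Pairwise (Function.onFun Disjoint (firstArgmin (n := n))) := by
  intro i j hij
  refine Set.disjoint_left.2 fun y hi hj => ?_
  rcases lt_or_gt_of_ne hij with h | h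
  · exact absurd (hj.2 i h) (not_lt.2 (hi.1 j))
  · exact absurd (hi.2 j h) (not_lt.2 (hj.1 i))

lemma iUnion_firstArgmin {n : ℕ} [Nonempty (Fin n)] :
    ⋃ i, firstArgmin (n := n) i = univ := by
  refine eq_univ_of_forall fun y => mem_iUnion.2 ?_
  obtain ⟨i, hi, hmin⟩ := WellFounded.has_min (wellFounded_lt (α := Fin n))
    {i | ∀ j, y i ≤ y j} (Finite.exists_min y)
  refine ⟨i, hi, fun j hj => lt_of_not_ge fun h => hmin j (fun k => h.trans (hi k)) hj⟩

lemma volume_eq_sum_inter_firstArgmin {n : ℕ} [Nonempty (Fin n)] (s : Set (Fin n → ℝ)) :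
    volume s = ∑ i, volume (s ∩ firstArgmin i) := by
  have h := measure_iUnion (μ := volume.restrict s) (pairwise_disjoint_firstArgmin (n := n))
    measurableSet_firstArgmin
  rw [iUnion_firstArgmin, Measure.restrict_apply_univ, tsum_fintype] at h
  rw [h]
  refine Finset.sum_congr rfl fun i _ => ?_
  rw [Measure.restrict_apply (measurableSet_firstArgmin i), inter_comm]

lemma ciInf_eq_of_mem_firstArgmin {n : ℕ} {i : Fin n} {y : Fin n → ℝ}
    (h : y ∈ firstArgmin i) : ⨅ j, y j = y i :=
  have : Nonempty (Fin n) := ⟨i⟩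
  le_antisymm (ciInf_le (finite_range y).bddBelow i) (le_ciInf h.1)

lemma finite_ciSup_lt_iff {ι : Type*} [Finite ι] [Nonempty ι] (y : ι → ℝ) (t : ℝ) :
    ⨆ j, y j < t ↔ ∀ j, y j < t := by
  refine ⟨fun h j => (le_ciSup (finite_range y).bddAbove j).trans_lt h, fun h => ?_⟩
  obtain ⟨j, hj⟩ := exists_eq_ciSup_of_finite (f := y)
  exact hj ▸ h j

lemma ciInf_one_sub {ι : Type*} [Finite ι] [Nonempty ι] (y : ι → ℝ) :
    ⨅ j, (1 - y j) = 1 - ⨆ j, y j := by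
  refine le_antisymm ?_ (le_ciInf fun j =>
    sub_le_sub_left (le_ciSup (finite_range y).bddAbove j) 1)
  obtain ⟨j, hj⟩ := exists_eq_ciSup_of_finite (f := y)
  rw [← hj]
  exact ciInf_le (finite_range fun j => 1 - y j).bddBelow j

/-- The nonnegative points whose minimum is less than `c` times one minus their maximum. -/
def lowTail (n : ℕ) (c : ℝ) : Set (Fin n → ℝ) :=
  {y | (∀ i, 0 ≤ y i) ∧ ⨅ i, y i < c * (1 - ⨆ i, y i)}

lemma measurableSet_lowTail (n : ℕ) (c : ℝ) : MeasurableSet (lowTail n c) := by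
  have h1 : Measurable fun y : Fin n → ℝ => ⨅ i, y i :=
    Measurable.iInf fun i => measurable_pi_apply i
  have h2 : Measurable fun y : Fin n → ℝ => ⨆ i, y i :=
    Measurable.iSup fun i => measurable_pi_apply i
  have h3 : MeasurableSet {y : Fin n → ℝ | ∀ i, 0 ≤ y i} := measurableSet_Ici (a := 0)
  exact h3.inter (measurableSet_lt h1 ((measurable_const.sub h2).const_mul c))

/-- Adding `c⁻¹` times the minimum to every coordinate maps `lowTail n c` onto the unit cube,
and is linear with determinant `1 + c⁻¹` on each `firstArgmin i`. -/
lemma volume_lowTail (n : ℕ) [Nonempty (Fin n)] {c : ℝ} (hc : 0 < c) :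
    volume (lowTail n c) = ENNReal.ofReal (c / (1 + c)) := by
  set cube : Set (Fin n → ℝ) := univ.pi fun _ => Ico 0 1 with hcube
  have hvol : volume cube = 1 := by
    have := Real.volume_pi_Ico (a := fun _ : Fin n => (0 : ℝ)) (b := fun _ => 1)
    simpa using this
  have key : ∀ i : Fin n, volume (lowTail n c ∩ firstArgmin i) =
      ENNReal.ofReal (c / (1 + c)) * volume (cube ∩ firstArgmin i) := by
    intro i
    let L : (Fin n → ℝ) →ₗ[ℝ] (Fin n → ℝ) :=
      LinearMap.transvection (LinearMap.proj i) fun _ => c⁻¹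
    have hL : ∀ y j, L y j = y j + y i * c⁻¹ := fun y j => rfl
    have hdet : LinearMap.det L = 1 + c⁻¹ := LinearMap.transvection.det _ _
    have hpos : 0 < 1 + c⁻¹ := by positivity
    have hpre : lowTail n c ∩ firstArgmin i = L ⁻¹' (cube ∩ firstArgmin i) := by
      ext y
      have hmem : L y ∈ firstArgmin i ↔ y ∈ firstArgmin i := by
        simp [firstArgmin, hL]
      rw [mem_preimage, mem_inter_iff, mem_inter_iff, hmem]
      refine and_congr_left fun hy => ?_
      have hsup : ⨅ j, y j < c * (1 - ⨆ j, y j) ↔ ∀ j, L y j < 1 := by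
        rw [ciInf_eq_of_mem_firstArgmin hy, ← div_lt_iff₀' hc, lt_sub_comm, finite_ciSup_lt_iff]
        simp only [hL, lt_sub_iff_add_lt, div_eq_mul_inv]
      have hnonneg : (∀ j, 0 ≤ y j) ↔ ∀ j, 0 ≤ L y j := by
        simp only [hL]
        constructor
        · intro h j
          have := h i
          have := h j
          positivity
        · intro h j
          have h1 : 0 ≤ y i * (1 + c⁻¹) := by linarith [h i]
          exact (nonneg_of_mul_nonneg_left h1 hpos).trans (hy.1 j)
      simp only [lowTail, mem_ofPred_eq, hsup, hnonneg, hcube, mem_univ_pi, mem_Ico, forall_and]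
    rw [hpre, Measure.addHaar_preimage_linearMap _ (hdet ▸ hpos.ne'), hdet,
      abs_of_pos (inv_pos.2 hpos)]
    congr 2
    field_simp
    ring
  rw [volume_eq_sum_inter_firstArgmin, Finset.sum_congr rfl fun i _ => key i, ← Finset.mul_sum,
    ← volume_eq_sum_inter_firstArgmin, hvol, mul_one]

lemma lowTail_le_one {n : ℕ} {c : ℝ} (hc : 0 < c) {y : Fin n → ℝ} (hy : y ∈ lowTail n c)
    (i : Fin n) : y i ≤ 1 := by
  have : Nonempty (Fin n) := ⟨i⟩
  have h := (le_ciInf hy.1).trans_lt hy.2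
  have := le_ciSup (finite_range y).bddAbove i
  linarith [pos_of_mul_pos_right h hc.le]

/-- Exact coverage in the uniform-model example `Unif(θ, θ+1)`: the Lebesgue measure
(volume on ℝⁿ) of the set of `y ∈ [0,1]ⁿ` with
`(α/(2-α))·(1 - maxᵢ yᵢ) ≤ minᵢ yᵢ ≤ ((2-α)/α)·(1 - maxᵢ yᵢ)` equals `1 - α`. -/
theorem uniform_example_exact_coverage
    (n : ℕ) (hn : 1 ≤ n) (α : ℝ) (hα : α ∈ Ioo (0:ℝ) 1) :
    volume {y : Fin n → ℝ |
      (∀ i, y i ∈ Icc (0:ℝ) 1) ∧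
      (α / (2 - α)) * (1 - ⨆ i, y i) ≤ ⨅ i, y i ∧
      (⨅ i, y i) ≤ ((2 - α) / α) * (1 - ⨆ i, y i)} = ENNReal.ofReal (1 - α) := by
  obtain ⟨h0, h1⟩ := hα
  have : Nonempty (Fin n) := ⟨⟨0, hn⟩⟩
  have h2 : 0 < 2 - α := by linarith
  set c := α / (2 - α) with hc_def
  have hc : 0 < c := div_pos h0 h2
  have hc1 : c < 1 := by rw [hc_def, div_lt_one h2]; linarith
  have hcinv : (2 - α) / α = c⁻¹ := by rw [hc_def, inv_div]
  have hcα : c / (1 + c) = α / 2 := by rw [hc_def]; field_simp; ring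
  let R : (Fin n → ℝ) → (Fin n → ℝ) := fun y => 1 - y
  have hR : MeasurePreserving R volume volume := Measure.measurePreserving_sub_left volume 1
  have hRmem : ∀ y, y ∈ R ⁻¹' lowTail n c ↔ (∀ i, y i ≤ 1) ∧ 1 - ⨆ i, y i < c * ⨅ i, y i := by
    intro y
    have hinv : ⨆ i, (1 - y i) = 1 - ⨅ i, y i := by
      have := ciInf_one_sub fun i => 1 - y i
      simp only [sub_sub_cancel] at this
      linarith
    simp [lowTail, R, hinv, ciInf_one_sub]
  have hset : {y : Fin n → ℝ | (∀ i, y i ∈ Icc (0:ℝ) 1) ∧ c * (1 - ⨆ i, y i) ≤ ⨅ i, y i ∧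
      (⨅ i, y i) ≤ ((2 - α) / α) * (1 - ⨆ i, y i)} =
      Icc 0 1 \ (lowTail n c ∪ R ⁻¹' lowTail n c) := by
    ext y
    simp only [mem_sdiff, mem_union, hRmem, mem_ofPred_eq, mem_Icc, Pi.le_def, Pi.zero_apply,
      Pi.one_apply, forall_and]
    refine and_congr_right fun hy => ?_
    rw [hcinv, ← div_eq_inv_mul, le_div_iff₀' hc]
    simp [lowTail, hy.1, hy.2]
  have hsub : lowTail n c ∪ R ⁻¹' lowTail n c ⊆ Icc 0 1 := by
    rintro y (hy | hy)
    · exact ⟨hy.1, lowTail_le_one hc hy⟩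
    · refine ⟨fun i => ?_, ((hRmem y).1 hy).1⟩
      have : 1 - y i ≤ 1 := lowTail_le_one hc hy i
      simpa using this
  have hdisj : Disjoint (lowTail n c) (R ⁻¹' lowTail n c) := by
    refine Set.disjoint_left.2 fun y hy hy' => ?_
    have hlt := hy.2
    have hlt' := ((hRmem y).1 hy').2
    have hnn : 0 ≤ ⨅ i, y i := le_ciInf hy.1
    nlinarith [mul_lt_mul_of_pos_left hlt' hc, mul_nonneg hc.le hnn]
  have hmeas := measurableSet_lowTail n c
  have hmeas' := hR.measurable hmeas
  have hunion : volume (lowTail n c ∪ R ⁻¹' lowTail n c) = ENNReal.ofReal α := by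
    rw [measure_union hdisj hmeas', hR.measure_preimage hmeas.nullMeasurableSet,
      volume_lowTail n hc, hcα, ← ENNReal.ofReal_add (by positivity) (by positivity), add_halves]
  rw [hset, measure_sdiff hsub (hmeas.union hmeas').nullMeasurableSet (by simp [hunion]), hunion,
    Real.volume_Icc_pi, ENNReal.ofReal_sub _ h0.le]
  simp
end
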